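/- arXiv:2412.16002 — 11 statements merged into one kernel-verified Lean document; each statement's English description precedes it below -/
import Mathlib

section
/- Let γ > 1, let ν ∈ ℝ^d be a unit vector, and let u = (ρ, m, E) ∈ ℝ × ℝ^d × ℝ with ρ > 0, velocity w = m/ρ, and pressure p = (γ−1)(E − |m|²/(2ρ)). Let a₀ > |w·ν| and let σ ∈ {+1, −1}. Write u − σ a₀⁻¹ f(u)·ν = (ρ', m', E') and let p' = (γ−1)(E' − |m'|²/(2ρ')) be the pressure of this new state. Then p' = (1 − ((γ−1)/(2 (a₀ − σ (w·ν))²)) (p/ρ)) (1 − σ a₀⁻¹ (w·ν)) p. -/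
open RealInnerProductSpace

/-- pressure of the state `u − σ a₀⁻¹ f(u)·ν`. -/
theorem stmt_1 {d : ℕ} (γ : ℝ) (hγ : 1 < γ)
    (ν : EuclideanSpace ℝ (Fin d)) (hν : ‖ν‖ = 1)
    (ρ : ℝ) (m : EuclideanSpace ℝ (Fin d)) (E : ℝ) (hρ : 0 < ρ)
    (w : EuclideanSpace ℝ (Fin d)) (hw : w = ρ⁻¹ • m)
    (p : ℝ) (hp : p = (γ - 1) * (E - ‖m‖ ^ 2 / (2 * ρ)))
    (a₀ : ℝ) (ha : |(⟪w, ν⟫)| < a₀)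
    (σ : ℝ) (hσ : σ = 1 ∨ σ = -1)
    (ρ' : ℝ) (m' : EuclideanSpace ℝ (Fin d)) (E' : ℝ)
    (hρ' : ρ' = ρ - σ * a₀⁻¹ * ⟪m, ν⟫)
    (hm' : m' = m - (σ * a₀⁻¹) • ((⟪m, ν⟫ / ρ) • m + p • ν))
    (hE' : E' = E - σ * a₀⁻¹ * ((E + p) * ⟪m, ν⟫ / ρ))
    (p' : ℝ) (hp' : p' = (γ - 1) * (E' - ‖m'‖ ^ 2 / (2 * ρ'))) :
    p' = (1 - (γ - 1) / (2 * (a₀ - σ * ⟪w, ν⟫) ^ 2) * (p / ρ)) *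
      ((1 - σ * a₀⁻¹ * ⟪w, ν⟫) * p) := by
  have ha₀ : 0 < a₀ := (abs_nonneg _).trans_lt ha
  have hm : m = ρ • w := by rw [hw, smul_inv_smul₀ hρ.ne']
  obtain ⟨n, hn⟩ : ∃ n : ℝ, n = ⟪w, ν⟫ := ⟨_, rfl⟩
  have hmn : ⟪m, ν⟫ = ρ * n := by rw [hm, real_inner_smul_left, hn]
  rw [hmn] at hρ' hm' hE'
  rw [← hn] at ha ⊢
  have hσ2 : σ ^ 2 = 1 := by rcases hσ with h | h <;> simp [h]
  have hk : 0 < a₀ - σ * n := by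
    have := abs_lt.mp ha
    rcases hσ with h | h <;> subst h <;> linarith
  have hm'' : m' = (1 - σ * a₀⁻¹ * n) • m - (σ * a₀⁻¹ * p) • ν := by
    rw [hm', mul_div_cancel_left₀ n hρ.ne']
    module
  have hnorm : ‖m'‖ ^ 2 = (1 - σ * a₀⁻¹ * n) ^ 2 * ‖m‖ ^ 2
      - 2 * (1 - σ * a₀⁻¹ * n) * (σ * a₀⁻¹ * p) * (ρ * n) + (σ * a₀⁻¹ * p) ^ 2 := by
    rw [hm'', norm_sub_sq_real, real_inner_smul_left, real_inner_smul_right, hmn, norm_smul,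
      norm_smul, hν, mul_pow, mul_one, Real.norm_eq_abs, Real.norm_eq_abs, sq_abs, sq_abs]
    ring
  obtain ⟨k, hkdef⟩ : ∃ k : ℝ, k = 1 - σ * a₀⁻¹ * n := ⟨_, rfl⟩
  have hak : a₀ - σ * n = a₀ * k := by rw [hkdef]; field_simp
  have hk0 : k ≠ 0 := by
    rintro h
    simp [hak, h] at hk
  have hρ'' : ρ' = ρ * k := by rw [hρ', hkdef]; ring
  have hE'' : E' = k * E - σ * a₀⁻¹ * p * n := by rw [hE', hkdef]; field_simp; ring
  have hinv : (σ * a₀⁻¹ * p) ^ 2 = p ^ 2 / a₀ ^ 2 := by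
    rw [mul_pow, mul_pow, hσ2, inv_pow]; ring
  rw [← hkdef, hinv] at hnorm
  rw [← hkdef, hak]
  have key : p' = k * ((γ - 1) * (E - ‖m‖ ^ 2 / (2 * ρ)))
      - (γ - 1) * (p ^ 2 / a₀ ^ 2) / (2 * (ρ * k)) := by
    rw [hp', hE'', hnorm, hρ'']
    field_simp
    ring
  rw [key, ← hp]
  field_simp
end

section
/- Let γ > 1, let ν ∈ ℝ^d be a unit vector, and let u = (ρ, m, E) ∈ ℝ × ℝ^d × ℝ with ρ > 0, p = (γ−1)(E − |m|²/(2ρ)) > 0, and velocity w = m/ρ. Let a₀ > |w·ν| and σ ∈ {+1, −1}. Write u − σ a₀⁻¹ f(u)·ν = (ρ', m', E') with pressure p' = (γ−1)(E' − |m'|²/(2ρ')). Then p' > 0 if and only if ((γ−1)/2)(p/ρ) < (a₀ − σ (w·ν))², equivalently √(γ p/ρ) < √(2γ/(γ−1)) (a₀ − σ (w·ν)). -/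
open RealInnerProductSpace

/-- positivity criterion for the pressure of `u − σ a₀⁻¹ f(u)·ν`. -/
theorem stmt_2 {d : ℕ} (γ : ℝ) (hγ : 1 < γ)
    (ν : EuclideanSpace ℝ (Fin d)) (hν : ‖ν‖ = 1)
    (ρ : ℝ) (m : EuclideanSpace ℝ (Fin d)) (E : ℝ) (hρ : 0 < ρ)
    (w : EuclideanSpace ℝ (Fin d)) (hw : w = ρ⁻¹ • m)
    (p : ℝ) (hp : p = (γ - 1) * (E - ‖m‖ ^ 2 / (2 * ρ))) (hppos : 0 < p)
    (a₀ : ℝ) (ha : |(⟪w, ν⟫)| < a₀)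
    (σ : ℝ) (hσ : σ = 1 ∨ σ = -1)
    (ρ' : ℝ) (m' : EuclideanSpace ℝ (Fin d)) (E' : ℝ)
    (hρ' : ρ' = ρ - σ * a₀⁻¹ * ⟪m, ν⟫)
    (hm' : m' = m - (σ * a₀⁻¹) • ((⟪m, ν⟫ / ρ) • m + p • ν))
    (hE' : E' = E - σ * a₀⁻¹ * ((E + p) * ⟪m, ν⟫ / ρ))
    (p' : ℝ) (hp' : p' = (γ - 1) * (E' - ‖m'‖ ^ 2 / (2 * ρ'))) :
    (0 < p' ↔ (γ - 1) / 2 * (p / ρ) < (a₀ - σ * ⟪w, ν⟫) ^ 2) ∧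
    ((γ - 1) / 2 * (p / ρ) < (a₀ - σ * ⟪w, ν⟫) ^ 2 ↔
      Real.sqrt (γ * p / ρ) < Real.sqrt (2 * γ / (γ - 1)) * (a₀ - σ * ⟪w, ν⟫)) := by
  have hγ0 : 0 < γ - 1 := by linarith
  have ha0 : 0 < a₀ := (abs_nonneg _).trans_lt ha
  obtain ⟨h₁, h₂⟩ := abs_lt.mp ha
  have hσ2 : σ ^ 2 = 1 := by rcases hσ with rfl | rfl <;> norm_num
  have hB : 0 < a₀ - σ * ⟪w, ν⟫ := by rcases hσ with rfl | rfl <;> linarith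
  have hmν : ⟪m, ν⟫ = ρ * ⟪w, ν⟫ := by
    rw [hw, real_inner_smul_left]
    field_simp
  set v : ℝ := ⟪w, ν⟫
  set B : ℝ := a₀ - σ * v with hBdef
  have hm'' : m' = (B / a₀) • m - (σ * a₀⁻¹ * p) • ν := by
    have h₃ : B / a₀ = 1 - σ * a₀⁻¹ * v := by
      rw [hBdef]
      field_simp
    rw [hm', hmν, mul_div_cancel_left₀ _ hρ.ne', h₃]
    module
  have hnorm : ‖m'‖ ^ 2 = (B / a₀) ^ 2 * ‖m‖ ^ 2
      - 2 * (B / a₀) * (σ * a₀⁻¹ * p) * (ρ * v) + (p / a₀) ^ 2 := by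
    rw [hm'', norm_sub_sq_real, norm_smul, norm_smul, real_inner_smul_left,
      real_inner_smul_right, hν, hmν, mul_pow, mul_pow, Real.norm_eq_abs, Real.norm_eq_abs,
      sq_abs, sq_abs]
    linear_combination (a₀⁻¹ * p) ^ 2 * hσ2
  have hE : E = p / (γ - 1) + ‖m‖ ^ 2 / (2 * ρ) := by
    rw [hp]
    field_simp
    ring
  have hρ'' : ρ' = ρ * (B / a₀) := by
    rw [hρ', hmν, hBdef]
    field_simp
  have hE'' : E' = (B / a₀) * E - σ * a₀⁻¹ * p * v := by
    rw [hE', hmν, hBdef]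
    field_simp
    ring
  have hpeq : p' = p / (a₀ * B) * (B ^ 2 - (γ - 1) / 2 * (p / ρ)) := by
    rw [hp', hnorm, hρ'', hE'', hE]
    clear_value B
    field_simp
    ring
  refine ⟨?_, ?_⟩
  · rw [hpeq, mul_pos_iff_of_pos_left (by positivity), sub_pos]
  · have hK : 0 < 2 * γ / (γ - 1) := div_pos (by linarith) hγ0
    have hsound : γ * p / ρ = 2 * γ / (γ - 1) * ((γ - 1) / 2 * (p / ρ)) := by
      field_simp
    rw [hsound, Real.sqrt_mul hK.le, mul_lt_mul_iff_right₀ (Real.sqrt_pos.mpr hK),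
      Real.sqrt_lt' hB]
end

section
/- (Lax–Friedrichs splitting property for the compressible Euler equations.) Let γ > 1, let ν ∈ ℝ^d be a unit vector, and let u = (ρ, m, E) ∈ ℝ × ℝ^d × ℝ be a state with ρ > 0 and p = (γ−1)(E − |m|²/(2ρ)) > 0. Let w = m/ρ, let c = √(γ p/ρ), and let a₀ ≥ |w·ν| + c. Then for both signs σ ∈ {+1, −1}, the state u + σ a₀⁻¹ f(u)·ν = (ρ', m', E') satisfies ρ' > 0 and p' = (γ−1)(E' − |m'|²/(2ρ')) > 0; that is, u ± a₀⁻¹ f(u)·ν lies in the invariant region B = { (ρ, m, E) : ρ > 0 and (γ−1)(E − |m|²/(2ρ)) > 0 }. -/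
open RealInnerProductSpace

/-- The pressure of the state `u + s • f(u)·ν`, in closed form. Here `v` is the normal velocity. -/
theorem euler_pressure_add_smul_flux {F : Type*} [NormedAddCommGroup F] [InnerProductSpace ℝ F]
    {γ ρ E p v s : ℝ} {m ν : F} (hν : ‖ν‖ = 1) (hρ : ρ ≠ 0)
    (hp : p = (γ - 1) * (E - ‖m‖ ^ 2 / (2 * ρ))) (hv : ⟪m, ν⟫ = ρ * v) (hk : 1 + s * v ≠ 0) :
    (γ - 1) * ((E + s * ((E + p) * ⟪m, ν⟫ / ρ)) -
        ‖m + s • ((⟪m, ν⟫ / ρ) • m + p • ν)‖ ^ 2 / (2 * (ρ + s * ⟪m, ν⟫))) =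
      (1 + s * v) * p - (γ - 1) * (s ^ 2 * p ^ 2) / (2 * ρ * (1 + s * v)) := by
  have hm : m + s • ((⟪m, ν⟫ / ρ) • m + p • ν) = (1 + s * v) • m + (s * p) • ν := by
    rw [hv, mul_div_cancel_left₀ v hρ]
    module
  have hnorm : ‖(1 + s * v) • m + (s * p) • ν‖ ^ 2 =
      (1 + s * v) ^ 2 * ‖m‖ ^ 2 + 2 * ((1 + s * v) * (s * p) * (ρ * v)) + (s * p) ^ 2 := by
    rw [norm_add_sq_real, norm_smul, norm_smul, real_inner_smul_left, real_inner_smul_right,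
      hv, hν, mul_pow, mul_pow, Real.norm_eq_abs, Real.norm_eq_abs, sq_abs, sq_abs]
    ring
  have hden : ρ + s * (ρ * v) = ρ * (1 + s * v) := by ring
  have henergy : (γ - 1) * E = p + (γ - 1) * (‖m‖ ^ 2 / (2 * ρ)) := by rw [hp]; ring
  rw [hm, hnorm, hv, hden]
  have hflux : (E + p) * (ρ * v) / ρ = (E + p) * v := by field_simp
  have hkin : ((1 + s * v) ^ 2 * ‖m‖ ^ 2 + 2 * ((1 + s * v) * (s * p) * (ρ * v)) + (s * p) ^ 2) /
      (2 * (ρ * (1 + s * v))) =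
      (1 + s * v) * (‖m‖ ^ 2 / (2 * ρ)) + s * p * v + s ^ 2 * p ^ 2 / (2 * ρ * (1 + s * v)) := by
    field_simp
  rw [hflux, hkin]
  linear_combination (1 + s * v) * henergy

/-- Lax–Friedrichs splitting property for the compressible Euler
equations: `u ± a₀⁻¹ f(u)·ν` remains in the invariant region (positive density
and pressure). -/
theorem stmt_3 {d : ℕ} (γ : ℝ) (hγ : 1 < γ)
    (ν : EuclideanSpace ℝ (Fin d)) (hν : ‖ν‖ = 1)
    (ρ : ℝ) (m : EuclideanSpace ℝ (Fin d)) (E : ℝ) (hρ : 0 < ρ)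
    (p : ℝ) (hp : p = (γ - 1) * (E - ‖m‖ ^ 2 / (2 * ρ))) (hppos : 0 < p)
    (w : EuclideanSpace ℝ (Fin d)) (hw : w = ρ⁻¹ • m)
    (c : ℝ) (hc : c = Real.sqrt (γ * p / ρ))
    (a₀ : ℝ) (ha : |(⟪w, ν⟫)| + c ≤ a₀) :
    ∀ σ : ℝ, (σ = 1 ∨ σ = -1) →
      0 < ρ + σ * a₀⁻¹ * ⟪m, ν⟫ ∧
      0 < (γ - 1) *
        ((E + σ * a₀⁻¹ * ((E + p) * ⟪m, ν⟫ / ρ)) -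
          ‖m + (σ * a₀⁻¹) • ((⟪m, ν⟫ / ρ) • m + p • ν)‖ ^ 2 /
            (2 * (ρ + σ * a₀⁻¹ * ⟪m, ν⟫))) := by
  intro σ hσ
  have hcpos : 0 < c := by rw [hc]; positivity
  have hcsq : c ^ 2 = γ * p / ρ := by rw [hc, Real.sq_sqrt (by positivity)]
  have ha₀ : 0 < a₀ := by linarith [abs_nonneg ⟪w, ν⟫]
  set v := ⟪w, ν⟫ with hvdef
  have hv : ⟪m, ν⟫ = ρ * v := by
    rw [hvdef, hw, real_inner_smul_left, mul_inv_cancel_left₀ hρ.ne']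
  have hlow : a₀⁻¹ * c ≤ 1 + σ * a₀⁻¹ * v := by
    have h : c ≤ a₀ + σ * v := by
      rcases hσ with rfl | rfl <;> linarith [neg_abs_le v, le_abs_self v]
    calc a₀⁻¹ * c ≤ a₀⁻¹ * (a₀ + σ * v) := by gcongr
      _ = 1 + σ * a₀⁻¹ * v := by field_simp
  have hk : 0 < 1 + σ * a₀⁻¹ * v := lt_of_lt_of_le (by positivity) hlow
  have hsq : (σ * a₀⁻¹) ^ 2 = a₀⁻¹ ^ 2 := by rcases hσ with rfl | rfl <;> ring
  refine ⟨?_, ?_⟩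
  · rw [hv]
    calc 0 < ρ * (1 + σ * a₀⁻¹ * v) := by positivity
      _ = ρ + σ * a₀⁻¹ * (ρ * v) := by ring
  · rw [euler_pressure_add_smul_flux hν hρ.ne' hp hv hk.ne', hsq, sub_pos,
      div_lt_iff₀ (by positivity)]
    have hksq : a₀⁻¹ ^ 2 * (γ * p) ≤ ρ * (1 + σ * a₀⁻¹ * v) ^ 2 := by
      calc a₀⁻¹ ^ 2 * (γ * p) = ρ * (a₀⁻¹ * c) ^ 2 := by rw [mul_pow, hcsq]; field_simp
        _ ≤ ρ * (1 + σ * a₀⁻¹ * v) ^ 2 := by gcongr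
    have hpos : 0 < (γ + 1) * (a₀⁻¹ ^ 2 * p ^ 2) := by positivity
    linarith [mul_le_mul_of_nonneg_left hksq hppos.le]
end

section
/- Let γ > 1, let ν ∈ ℝ^d be a unit vector, and let u = (ρ, m, E) ∈ ℝ × ℝ^d × ℝ with ρ > 0 and p = (γ−1)(E − |m|²/(2ρ)) > 0, velocity w = m/ρ, and let a₀ ≥ |w·ν| + √(γ p/ρ). Then for both signs σ ∈ {+1, −1} and for every w* ∈ ℝ^d, (σ a₀⁻¹ f(u)·ν) · n(w*) ≤ ((|w·ν| + √(((γ−1)/2)(p/ρ)))/a₀) (u · n(w*)) < u · n(w*), where n(w*) = (|w*|²/2, −w*, 1). -/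
open RealInnerProductSpace

/-- Weighted AM-GM: the pressure work is bounded by the acoustic speed
`√(((γ−1)/2)(p/ρ))` times the energy measured in a moving frame. -/
theorem pressure_mul_abs_le_sqrt_mul_energy {γ ρ p t r : ℝ} (hγ : 1 < γ) (hρ : 0 < ρ)
    (hp : 0 < p) (ht : |t| ≤ r) :
    p * |t| ≤ Real.sqrt ((γ - 1) / 2 * (p / ρ)) * (ρ * r ^ 2 / 2 + p / (γ - 1)) := by
  have hg : 0 < γ - 1 := sub_pos.2 hγ
  set c := Real.sqrt ((γ - 1) / 2 * (p / ρ)) with hc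
  have hc0 : 0 ≤ c := Real.sqrt_nonneg _
  have hc2 : c ^ 2 = (γ - 1) / 2 * (p / ρ) := Real.sq_sqrt (by positivity)
  have hpc : p = 2 * ρ * c ^ 2 / (γ - 1) := by
    rw [hc2]; field_simp
  have key : c * (ρ * r ^ 2 / 2 + p / (γ - 1)) - p * r
      = c * ρ / 2 * (r - 2 * c / (γ - 1)) ^ 2 := by
    rw [hpc]; field_simp; ring
  have hnonneg : 0 ≤ c * ρ / 2 * (r - 2 * c / (γ - 1)) ^ 2 := by positivity
  have hpr : p * |t| ≤ p * r := by gcongr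
  linarith

/-- `(σ a₀⁻¹ f(u)·ν) · n(w*) ≤ ((|w·ν| + √(((γ−1)/2)(p/ρ)))/a₀) (u·n(w*))
< u·n(w*)`, where `n(w*) = (|w*|²/2, −w*, 1)`. -/
theorem stmt_6 {d : ℕ} (γ : ℝ) (hγ : 1 < γ)
    (ν : EuclideanSpace ℝ (Fin d)) (hν : ‖ν‖ = 1)
    (ρ : ℝ) (m : EuclideanSpace ℝ (Fin d)) (E : ℝ) (hρ : 0 < ρ)
    (p : ℝ) (hp : p = (γ - 1) * (E - ‖m‖ ^ 2 / (2 * ρ))) (hppos : 0 < p)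
    (w : EuclideanSpace ℝ (Fin d)) (hw : w = ρ⁻¹ • m)
    (a₀ : ℝ) (ha : |(⟪w, ν⟫)| + Real.sqrt (γ * p / ρ) ≤ a₀) :
    ∀ σ : ℝ, (σ = 1 ∨ σ = -1) → ∀ ws : EuclideanSpace ℝ (Fin d),
      σ * a₀⁻¹ *
          (⟪m, ν⟫ * (‖ws‖ ^ 2 / 2) - ⟪(⟪m, ν⟫ / ρ) • m + p • ν, ws⟫ +
            (E + p) * ⟪m, ν⟫ / ρ) ≤
        (|(⟪w, ν⟫)| + Real.sqrt ((γ - 1) / 2 * (p / ρ))) / a₀ *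
          (ρ * (‖ws‖ ^ 2 / 2) - ⟪m, ws⟫ + E) ∧
      (|(⟪w, ν⟫)| + Real.sqrt ((γ - 1) / 2 * (p / ρ))) / a₀ *
          (ρ * (‖ws‖ ^ 2 / 2) - ⟪m, ws⟫ + E) <
        ρ * (‖ws‖ ^ 2 / 2) - ⟪m, ws⟫ + E := by
  intro σ hσ ws
  have hg : 0 < γ - 1 := sub_pos.2 hγ
  have hm : m = ρ • w := by rw [hw, smul_inv_smul₀ hρ.ne']
  have hE : E = p / (γ - 1) + ρ * ‖w‖ ^ 2 / 2 := by
    rw [hp, hm, norm_smul, Real.norm_of_nonneg hρ.le]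
    field_simp
    ring
  have hN : ρ * (‖ws‖ ^ 2 / 2) - ⟪m, ws⟫ + E = ρ * ‖w - ws‖ ^ 2 / 2 + p / (γ - 1) := by
    rw [hE, hm, norm_sub_sq_real, real_inner_smul_left]
    ring
  have hF : ⟪m, ν⟫ * (‖ws‖ ^ 2 / 2) - ⟪(⟪m, ν⟫ / ρ) • m + p • ν, ws⟫ + (E + p) * ⟪m, ν⟫ / ρ
      = ⟪w, ν⟫ * (ρ * ‖w - ws‖ ^ 2 / 2 + p / (γ - 1)) + p * ⟪w - ws, ν⟫ := by
    rw [← hN, hm, inner_add_left, inner_sub_left, real_inner_comm ν ws]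
    simp only [real_inner_smul_left]
    field_simp
    ring
  rw [hF, hN]
  set N := ρ * ‖w - ws‖ ^ 2 / 2 + p / (γ - 1)
  have hNpos : 0 < N := by positivity
  have hct : Real.sqrt ((γ - 1) / 2 * (p / ρ)) < Real.sqrt (γ * p / ρ) := by
    apply Real.sqrt_lt_sqrt (by positivity)
    rw [mul_div_assoc]
    exact mul_lt_mul_of_pos_right (by linarith) (by positivity)
  have ha0 : 0 < a₀ := by
    linarith [abs_nonneg ⟪w, ν⟫, Real.sqrt_nonneg ((γ - 1) / 2 * (p / ρ))]
  have hv : |⟪w - ws, ν⟫| ≤ ‖w - ws‖ := by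
    simpa [hν] using abs_real_inner_le_norm (w - ws) ν
  have hbound := pressure_mul_abs_le_sqrt_mul_energy hγ hρ hppos hv
  have hσabs : |σ| = 1 := by rcases hσ with rfl | rfl <;> simp
  constructor
  · rw [mul_comm σ, mul_assoc, div_mul_eq_mul_div, div_eq_inv_mul]
    refine mul_le_mul_of_nonneg_left ?_ (inv_nonneg.2 ha0.le)
    calc σ * (⟪w, ν⟫ * N + p * ⟪w - ws, ν⟫)
        ≤ |⟪w, ν⟫ * N + p * ⟪w - ws, ν⟫| := by
          simpa [abs_mul, hσabs] using le_abs_self (σ * (⟪w, ν⟫ * N + p * ⟪w - ws, ν⟫))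
      _ ≤ |⟪w, ν⟫| * N + p * |⟪w - ws, ν⟫| := by
          simpa [abs_mul, abs_of_pos hNpos, abs_of_pos hppos] using
            abs_add_le (⟪w, ν⟫ * N) (p * ⟪w - ws, ν⟫)
      _ ≤ (|⟪w, ν⟫| + Real.sqrt ((γ - 1) / 2 * (p / ρ))) * N := by
          rw [add_mul]
          gcongr
  · exact mul_lt_of_lt_one_left hNpos ((div_lt_one ha0).2 (by linarith))
end

section
/- Let γ > 1, let ν ∈ ℝ^d be a unit vector, and let u = (ρ, m, E) ∈ ℝ × ℝ^d × ℝ with ρ > 0 and p = (γ−1)(E − |m|²/(2ρ)) > 0, velocity w = m/ρ, and let a₀ ≥ |w·ν| + √(γ p/ρ). Then for both signs σ ∈ {+1, −1}, the state v = u + σ a₀⁻¹ f(u)·ν satisfies v · n₁ > 0 and v · n(w*) > 0 for every w* ∈ ℝ^d, where n₁ = (1, 0, 0) and n(w*) = (|w*|²/2, −w*, 1). -/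
open RealInnerProductSpace

/-- A scalar quadratic bound: under the wave-speed condition `s² γ p ≤ ρ t²`, the quadratic form
`ρ t x / 2 - s p ζ + p t / (γ - 1)` is positive whenever `ζ² ≤ x`. -/
lemma quadratic_pos_of_wave_speed {γ ρ p s t ζ x : ℝ} (hγ : 1 < γ) (hρ : 0 < ρ) (hp : 0 < p)
    (ht : 0 < t) (hst : s ^ 2 * (γ * p) ≤ ρ * t ^ 2) (hζ : ζ ^ 2 ≤ x) :
    0 < ρ * t * x / 2 - s * p * ζ + p * t / (γ - 1) := by
  have hg : 0 < γ - 1 := sub_pos.2 hγ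
  have hρt : 0 < ρ * t := mul_pos hρ ht
  have hx : ρ * t * ζ ^ 2 ≤ ρ * t * x := mul_le_mul_of_nonneg_left hζ hρt.le
  suffices 0 < ρ * t * ζ ^ 2 / 2 - s * p * ζ + p * t / (γ - 1) by linarith
  have hdisc : (γ - 1) * (s * p) ^ 2 < 2 * p * (ρ * t ^ 2) := by
    have h1 := mul_le_mul_of_nonneg_left hst hp.le
    have h2 : 0 < p * (ρ * t ^ 2) := by positivity
    nlinarith [sq_nonneg (s * p)]
  have key : 2 * (ρ * t) * (γ - 1) * (ρ * t * ζ ^ 2 / 2 - s * p * ζ + p * t / (γ - 1))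
      = (γ - 1) * (ρ * t * ζ - s * p) ^ 2
        + (2 * p * (ρ * t ^ 2) - (γ - 1) * (s * p) ^ 2) := by
    field_simp
    ring
  refine pos_of_mul_pos_right (a := 2 * (ρ * t) * (γ - 1)) ?_ (by positivity)
  rw [key]
  have : 0 ≤ (γ - 1) * (ρ * t * ζ - s * p) ^ 2 := by positivity
  linarith

/-- the state `v = u + σ a₀⁻¹ f(u)·ν` satisfies `v·n₁ > 0` and
`v·n(w*) > 0` for every `w*`, where `n₁ = (1,0,0)` and `n(w*) = (|w*|²/2, −w*, 1)`. -/
theorem stmt_7 {d : ℕ} (γ : ℝ) (hγ : 1 < γ)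
    (ν : EuclideanSpace ℝ (Fin d)) (hν : ‖ν‖ = 1)
    (ρ : ℝ) (m : EuclideanSpace ℝ (Fin d)) (E : ℝ) (hρ : 0 < ρ)
    (p : ℝ) (hp : p = (γ - 1) * (E - ‖m‖ ^ 2 / (2 * ρ))) (hppos : 0 < p)
    (w : EuclideanSpace ℝ (Fin d)) (hw : w = ρ⁻¹ • m)
    (a₀ : ℝ) (ha : |(⟪w, ν⟫)| + Real.sqrt (γ * p / ρ) ≤ a₀) :
    ∀ σ : ℝ, (σ = 1 ∨ σ = -1) →
      ∀ ρ' : ℝ, ∀ m' : EuclideanSpace ℝ (Fin d), ∀ E' : ℝ,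
        ρ' = ρ + σ * a₀⁻¹ * ⟪m, ν⟫ →
        m' = m + (σ * a₀⁻¹) • ((⟪m, ν⟫ / ρ) • m + p • ν) →
        E' = E + σ * a₀⁻¹ * ((E + p) * ⟪m, ν⟫ / ρ) →
        0 < ρ' ∧
        ∀ ws : EuclideanSpace ℝ (Fin d),
          0 < ρ' * (‖ws‖ ^ 2 / 2) - ⟪m', ws⟫ + E' := by
  rintro σ hσ ρ' m' E' rfl rfl rfl
  have hm : m = ρ • w := by rw [hw, smul_inv_smul₀ hρ.ne']
  have hg : 0 < γ - 1 := sub_pos.2 hγ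
  have hc : 0 < Real.sqrt (γ * p / ρ) := Real.sqrt_pos.2 (by positivity)
  have hc2 : Real.sqrt (γ * p / ρ) ^ 2 = γ * p / ρ := Real.sq_sqrt (by positivity)
  have ha₀ : 0 < a₀ := by linarith [abs_nonneg ⟪w, ν⟫]
  have hE : E = p / (γ - 1) + ρ * ‖w‖ ^ 2 / 2 := by
    rw [hp, hm, norm_smul, Real.norm_of_nonneg hρ.le]
    field_simp
    ring
  subst hm
  obtain ⟨s, hs⟩ : ∃ s, s = σ * a₀⁻¹ := ⟨_, rfl⟩
  obtain ⟨k, hk⟩ : ∃ k, k = ⟪w, ν⟫ := ⟨_, rfl⟩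
  rw [← hk] at ha
  have hσk : -|k| ≤ σ * k := by
    rcases hσ with rfl | rfl
    · simpa using neg_abs_le k
    · simpa using le_abs_self k
  have hσ2 : σ ^ 2 = 1 := by rcases hσ with rfl | rfl <;> norm_num
  have hta : a₀ * (1 + s * k) = a₀ + σ * k := by
    rw [hs]
    field_simp
  have hct : Real.sqrt (γ * p / ρ) ≤ a₀ * (1 + s * k) := by linarith
  have ht : 0 < 1 + s * k := pos_of_mul_pos_right (hc.trans_le hct) ha₀.le
  have hst : s ^ 2 * (γ * p) ≤ ρ * (1 + s * k) ^ 2 := by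
    have h1 : γ * p / ρ ≤ (a₀ * (1 + s * k)) ^ 2 := hc2 ▸ pow_le_pow_left₀ hc.le hct 2
    rw [div_le_iff₀ hρ] at h1
    have h2 : s ^ 2 * a₀ ^ 2 = 1 := by
      rw [hs, mul_pow, hσ2, one_mul, ← mul_pow, inv_mul_cancel₀ ha₀.ne', one_pow]
    calc s ^ 2 * (γ * p) ≤ s ^ 2 * ((a₀ * (1 + s * k)) ^ 2 * ρ) := by gcongr
      _ = (s ^ 2 * a₀ ^ 2) * (ρ * (1 + s * k) ^ 2) := by ring
      _ = ρ * (1 + s * k) ^ 2 := by rw [h2, one_mul]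
  rw [← hs, real_inner_smul_left, ← hk]
  refine ⟨?_, fun ws => ?_⟩
  · have := mul_pos hρ ht
    linarith
  have hζ : ⟪ν, ws - w⟫ ^ 2 ≤ ‖ws - w‖ ^ 2 := by
    have h := abs_real_inner_le_norm ν (ws - w)
    rw [hν, one_mul] at h
    exact sq_le_sq' (abs_le.1 h).1 (abs_le.1 h).2
  convert quadratic_pos_of_wave_speed hγ hρ hppos ht hst hζ using 1
  rw [norm_sub_sq_real, inner_sub_right, real_inner_comm w ν, ← hk, real_inner_comm w ws, hE]
  simp only [inner_add_left, real_inner_smul_left]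
  field_simp
  ring
end

section
/- (Scaling limiter preserves the bounds.) Let S be a finite nonempty set, let p : S → ℝ, and let m ≤ M be reals. Let ū ∈ ℝ satisfy m ≤ ū ≤ M and m_S ≤ ū ≤ M_S, where M_S = max_{x∈S} p(x) and m_S = min_{x∈S} p(x). Define θ ∈ [0,1] as the minimum of the set consisting of 1, of (M − ū)/(M_S − ū) whenever M_S > ū, and of (ū − m)/(ū − m_S) whenever m_S < ū. Then the scaled values p̃(x) = θ (p(x) − ū) + ū satisfy m ≤ p̃(x) ≤ M for all x ∈ S. -/
/-- the scaling limiter preserves the bounds `[m, M]`. -/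
theorem stmt_8 {ι : Type*} (S : Finset ι) (hS : S.Nonempty) (p : ι → ℝ)
    (m M : ℝ) (hmM : m ≤ M)
    (ub : ℝ) (hub1 : m ≤ ub) (hub2 : ub ≤ M)
    (MS mS : ℝ) (hMS : MS = S.sup' hS p) (hmS : mS = S.inf' hS p)
    (hub3 : mS ≤ ub) (hub4 : ub ≤ MS)
    (θ : ℝ)
    (hθ : θ = min 1 (min (if ub < MS then (M - ub) / (MS - ub) else 1)
                         (if mS < ub then (ub - m) / (ub - mS) else 1))) :
    (0 ≤ θ ∧ θ ≤ 1) ∧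
    ∀ x ∈ S, m ≤ θ * (p x - ub) + ub ∧ θ * (p x - ub) + ub ≤ M := by
  have h_one : θ ≤ 1 := hθ ▸ min_le_left _ _
  have h_nonneg : 0 ≤ θ := by
    rw [hθ]
    refine le_min zero_le_one (le_min ?_ ?_)
    · split_ifs with h
      · exact div_nonneg (sub_nonneg.2 hub2) (sub_nonneg.2 hub4)
      · exact zero_le_one
    · split_ifs with h
      · exact div_nonneg (sub_nonneg.2 hub1) (sub_nonneg.2 hub3)
      · exact zero_le_one
  have h_upper : θ * (MS - ub) ≤ M - ub := by
    rcases hub4.lt_or_eq with h | h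
    · have hle : θ ≤ (M - ub) / (MS - ub) := by
        rw [hθ, if_pos h]
        exact (min_le_right _ _).trans (min_le_left _ _)
      exact (le_div_iff₀ (sub_pos.2 h)).1 hle
    · rw [← h, sub_self, mul_zero]
      exact sub_nonneg.2 hub2
  have h_lower : θ * (ub - mS) ≤ ub - m := by
    rcases hub3.lt_or_eq with h | h
    · have hle : θ ≤ (ub - m) / (ub - mS) := by
        rw [hθ, if_pos h]
        exact (min_le_right _ _).trans (min_le_right _ _)
      exact (le_div_iff₀ (sub_pos.2 h)).1 hle
    · rw [h, sub_self, mul_zero]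
      exact sub_nonneg.2 hub1
  refine ⟨⟨h_nonneg, h_one⟩, fun x hx => ?_⟩
  have hp_le : p x ≤ MS := hMS ▸ Finset.le_sup' p hx
  have hle_p : mS ≤ p x := hmS ▸ Finset.inf'_le p hx
  have h₁ := mul_le_mul_of_nonneg_left hp_le h_nonneg
  have h₂ := mul_le_mul_of_nonneg_left hle_p h_nonneg
  constructor <;> linarith
end

section
/- (Density limiter.) Let S be a finite nonempty set, ρ : S → ℝ, ε > 0, and let ρ̄ ∈ ℝ satisfy ρ̄ ≥ ε and min_{x∈S} ρ(x) ≤ ρ̄. Define θ₁ = 1 if min_{x∈S} ρ(x) ≥ ε, and θ₁ = (ρ̄ − ε)/(ρ̄ − min_{x∈S} ρ(x)) otherwise. Then 0 ≤ θ₁ ≤ 1 and the limited values ρ̂(x) = θ₁ (ρ(x) − ρ̄) + ρ̄ satisfy ρ̂(x) ≥ ε for all x ∈ S. Moreover, if ρ̄ = Σ_{x∈S} λ_x ρ(x) for nonnegative weights λ_x summing to 1, then Σ_{x∈S} λ_x ρ̂(x) = ρ̄. -/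
/-- the density limiter produces values `≥ ε` and preserves the
cell average. -/
theorem stmt_9 {ι : Type*} (S : Finset ι) (hS : S.Nonempty) (ρ : ι → ℝ)
    (ε : ℝ) (hε : 0 < ε)
    (ρb : ℝ) (hρb : ε ≤ ρb) (hmin : S.inf' hS ρ ≤ ρb)
    (θ₁ : ℝ)
    (hθ₁ : θ₁ = if ε ≤ S.inf' hS ρ then 1 else (ρb - ε) / (ρb - S.inf' hS ρ)) :
    (0 ≤ θ₁ ∧ θ₁ ≤ 1) ∧
    (∀ x ∈ S, ε ≤ θ₁ * (ρ x - ρb) + ρb) ∧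
    (∀ lam : ι → ℝ, (∀ x ∈ S, 0 ≤ lam x) → (∑ x ∈ S, lam x) = 1 →
      ρb = ∑ x ∈ S, lam x * ρ x →
      ∑ x ∈ S, lam x * (θ₁ * (ρ x - ρb) + ρb) = ρb) := by
  have hle : ∀ x ∈ S, S.inf' hS ρ ≤ ρ x := fun x hx => Finset.inf'_le ρ hx
  generalize S.inf' hS ρ = m at *
  have key : (0 ≤ θ₁ ∧ θ₁ ≤ 1) ∧ ε ≤ θ₁ * (m - ρb) + ρb := by
    split_ifs at hθ₁ with h
    · subst hθ₁
      exact ⟨⟨zero_le_one, le_rfl⟩, by linarith⟩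
    · have hm : m < ε := not_le.mp h
      have hpos : 0 < ρb - m := by linarith
      have hmul : θ₁ * (ρb - m) = ρb - ε := by
        rw [hθ₁, div_mul_cancel₀ _ hpos.ne']
      refine ⟨⟨?_, ?_⟩, by linarith⟩
      · rw [hθ₁]
        exact div_nonneg (by linarith) hpos.le
      · rw [hθ₁, div_le_one hpos]
        linarith
  obtain ⟨hθ, hbound⟩ := key
  refine ⟨hθ, fun x hx => ?_, fun lam _ hsum havg => ?_⟩
  · have := mul_le_mul_of_nonneg_left (hle x hx) hθ.1
    linarith
  · calc ∑ x ∈ S, lam x * (θ₁ * (ρ x - ρb) + ρb)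
        = ∑ x ∈ S, (θ₁ * (lam x * ρ x) + (1 - θ₁) * ρb * lam x) :=
          Finset.sum_congr rfl fun x _ => by ring
      _ = θ₁ * ρb + (1 - θ₁) * ρb * 1 := by
          rw [Finset.sum_add_distrib, ← Finset.mul_sum, ← Finset.mul_sum, hsum, ← havg]
      _ = ρb := by ring
end

section
/- (Positivity-preserving limiter for the Euler equations.) Let S be a finite nonempty set, let u : S → ℝ × ℝ^d × ℝ assign to each x ∈ S a state u(x) = (ρ(x), m(x), E(x)), let λ_x ≥ 0 be weights with Σ_{x∈S} λ_x = 1, and let ū = (ρ̄, m̄, Ē) = Σ_{x∈S} λ_x u(x). Let ε > 0 and assume ρ̄ ≥ ε and g(ū) = Ē − |m̄|²/(2ρ̄) ≥ ε. First limit the density: set θ₁ = 1 if min_{x∈S} ρ(x) ≥ ε and θ₁ = (ρ̄ − ε)/(ρ̄ − min_{x∈S} ρ(x)) otherwise, and define û(x) = (θ₁(ρ(x) − ρ̄) + ρ̄, m(x), E(x)). Then limit the internal energy: set θ₂ = 1 if min_{x∈S} g(û(x)) ≥ ε and θ₂ = (g(ū) − ε)/(g(ū) − min_{x∈S} g(û(x)))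 otherwise, and define ũ(x) = θ₂ (û(x) − ū) + ū. Then for all x ∈ S, the limited state ũ(x) = (ρ̃(x), m̃(x), Ẽ(x)) satisfies ρ̃(x) ≥ ε and g(ũ(x)) = Ẽ(x) − |m̃(x)|²/(2ρ̃(x)) ≥ ε, and the average is preserved: Σ_{x∈S} λ_x ũ(x) = ū. -/
/-- The scaling factor that lifts values bounded below by `a` to values bounded below by `ε`,
keeping the reference value `b ≥ ε` fixed. -/
theorem scaling_factor_spec {a b ε θ : ℝ} (hb : ε ≤ b)
    (hθ : θ = if ε ≤ a then 1 else (b - ε) / (b - a)) :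
    0 ≤ θ ∧ θ ≤ 1 ∧ ∀ y, a ≤ y → ε ≤ θ * (y - b) + b := by
  split_ifs at hθ with h
  · subst hθ
    exact ⟨zero_le_one, le_rfl, fun y hy => by linarith⟩
  · push Not at h
    have hba : 0 < b - a := by linarith
    have h0 : 0 ≤ θ := hθ ▸ div_nonneg (by linarith) hba.le
    have hmul : θ * (b - a) = b - ε := by rw [hθ, div_mul_cancel₀ _ hba.ne']
    refine ⟨h0, ?_, fun y hy => ?_⟩
    · rw [hθ, div_le_one hba]
      linarith
    · nlinarith [mul_le_mul_of_nonneg_left hy h0]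

/-- Scaling around a weighted average does not change that average. -/
theorem sum_smul_scale_eq {ι V : Type*} [AddCommGroup V] [Module ℝ V] (S : Finset ι)
    (w : ι → ℝ) (hw : ∑ x ∈ S, w x = 1) (f : ι → V) (c : V)
    (hc : ∑ x ∈ S, w x • f x = c) (θ : ℝ) :
    ∑ x ∈ S, w x • (θ • (f x - c) + c) = c := by
  simp only [smul_add, smul_sub, Finset.sum_add_distrib, Finset.sum_sub_distrib,
    smul_comm _ θ, ← Finset.smul_sum, ← Finset.sum_smul, hw, hc, one_smul, sub_self, zero_add]

theorem tangent_le_sq_div {r : ℝ} (hr : 0 < r) (a c : ℝ) :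
    c * a - c ^ 2 * r / 2 ≤ a ^ 2 / (2 * r) := by
  rw [le_div_iff₀ (by positivity)]
  nlinarith [sq_nonneg (a - c * r)]

/-- Concavity of the internal energy density along segments of states with positive density. -/
theorem internal_energy_concave {V : Type*} [SeminormedAddCommGroup V] [NormedSpace ℝ V]
    {r s θ : ℝ} (hr : 0 < r) (hs : 0 < s) (h0 : 0 ≤ θ) (h1 : θ ≤ 1) (m n : V) (E F : ℝ) :
    θ * ((E - ‖m‖ ^ 2 / (2 * r)) - (F - ‖n‖ ^ 2 / (2 * s))) + (F - ‖n‖ ^ 2 / (2 * s)) ≤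
      (θ * (E - F) + F) - ‖θ • (m - n) + n‖ ^ 2 / (2 * (θ * (r - s) + s)) := by
  have hR : 0 < θ * (r - s) + s := by
    rcases h0.eq_or_lt with rfl | h
    · simpa using hs
    · nlinarith [mul_pos h hr, mul_nonneg (sub_nonneg.2 h1) hs.le]
  set R := θ * (r - s) + s with hRdef
  set N := ‖θ • (m - n) + n‖ with hN
  have hle : N ≤ θ * ‖m‖ + (1 - θ) * ‖n‖ := by
    have : θ • (m - n) + n = θ • m + (1 - θ) • n := by module
    rw [hN, this]
    refine (norm_add_le _ _).trans_eq ?_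
    rw [norm_smul, norm_smul, Real.norm_of_nonneg h0, Real.norm_of_nonneg (sub_nonneg.2 h1)]
  have hc : 0 ≤ N / R := div_nonneg (norm_nonneg _) hR.le
  have hNc : N ^ 2 / (2 * R) = N / R * N - (N / R) ^ 2 * R / 2 := by
    field_simp
    ring
  have hm := mul_le_mul_of_nonneg_left (tangent_le_sq_div hr ‖m‖ (N / R)) h0
  have hn := mul_le_mul_of_nonneg_left (tangent_le_sq_div hs ‖n‖ (N / R)) (sub_nonneg.2 h1)
  have hmul := mul_le_mul_of_nonneg_left hle hc
  rw [hNc]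
  generalize N / R = c at *
  rw [hRdef]
  linarith

/-- the positivity-preserving limiter for the Euler equations
produces states in `B^ε` and preserves the cell average. -/
theorem stmt_11 {d : ℕ} {ι : Type*} (S : Finset ι) (hS : S.Nonempty)
    (ρ : ι → ℝ) (m : ι → EuclideanSpace ℝ (Fin d)) (E : ι → ℝ)
    (lam : ι → ℝ) (hlam : ∀ x ∈ S, 0 ≤ lam x) (hsum : (∑ x ∈ S, lam x) = 1)
    (ρb : ℝ) (mb : EuclideanSpace ℝ (Fin d)) (Eb : ℝ)
    (hρb : ρb = ∑ x ∈ S, lam x * ρ x)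
    (hmb : mb = ∑ x ∈ S, lam x • m x)
    (hEb : Eb = ∑ x ∈ S, lam x * E x)
    (ε : ℝ) (hε : 0 < ε)
    (h1 : ε ≤ ρb) (h2 : ε ≤ Eb - ‖mb‖ ^ 2 / (2 * ρb))
    (θ₁ : ℝ)
    (hθ₁ : θ₁ = if ε ≤ S.inf' hS ρ then 1 else (ρb - ε) / (ρb - S.inf' hS ρ))
    (ρh : ι → ℝ) (hρh : ∀ x, ρh x = θ₁ * (ρ x - ρb) + ρb)
    (gh : ι → ℝ) (hgh : ∀ x, gh x = E x - ‖m x‖ ^ 2 / (2 * ρh x))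
    (θ₂ : ℝ)
    (hθ₂ : θ₂ = if ε ≤ S.inf' hS gh then 1
      else ((Eb - ‖mb‖ ^ 2 / (2 * ρb)) - ε) /
        ((Eb - ‖mb‖ ^ 2 / (2 * ρb)) - S.inf' hS gh))
    (ρt : ι → ℝ) (mt : ι → EuclideanSpace ℝ (Fin d)) (Et : ι → ℝ)
    (hρt : ∀ x, ρt x = θ₂ * (ρh x - ρb) + ρb)
    (hmt : ∀ x, mt x = θ₂ • (m x - mb) + mb)
    (hEt : ∀ x, Et x = θ₂ * (E x - Eb) + Eb) :
    (∀ x ∈ S, ε ≤ ρt x ∧ ε ≤ Et x - ‖mt x‖ ^ 2 / (2 * ρt x)) ∧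
    (∑ x ∈ S, lam x * ρt x) = ρb ∧
    (∑ x ∈ S, lam x • mt x) = mb ∧
    (∑ x ∈ S, lam x * Et x) = Eb := by
  obtain ⟨-, -, hlow₁⟩ := scaling_factor_spec h1 hθ₁
  obtain ⟨h0, h1', hlow₂⟩ := scaling_factor_spec h2 hθ₂
  have hρh_le : ∀ x ∈ S, ε ≤ ρh x := fun x hx => by
    rw [hρh]
    exact hlow₁ _ (Finset.inf'_le _ hx)
  have hρh_avg : ∑ x ∈ S, lam x * ρh x = ρb := by
    simpa only [hρh, smul_eq_mul] using sum_smul_scale_eq S lam hsum ρ ρb hρb.symm θ₁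
  refine ⟨fun x hx => ⟨?_, ?_⟩, ?_, ?_, ?_⟩
  · rw [hρt]
    nlinarith [mul_le_mul_of_nonneg_left (hρh_le x hx) h0,
      mul_le_mul_of_nonneg_left h1 (sub_nonneg.2 h1')]
  · have hg := hlow₂ _ (Finset.inf'_le gh hx)
    rw [hgh] at hg
    rw [hρt, hmt, hEt]
    exact hg.trans (internal_energy_concave (hε.trans_le (hρh_le x hx)) (hε.trans_le h1)
      h0 h1' (m x) mb (E x) Eb)
  · simpa only [hρt, smul_eq_mul] using sum_smul_scale_eq S lam hsum ρh ρb hρh_avg θ₂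
  · simpa only [hmt] using sum_smul_scale_eq S lam hsum m mb hmb.symm θ₂
  · simpa only [hEt, smul_eq_mul] using sum_smul_scale_eq S lam hsum E Eb hEb.symm θ₂
end

section
/- (Convex decomposition of the second-order cRKDG step.) Let V be a real vector space, let F, G : V → V be arbitrary maps, let Δt, a₂₁, b₁, b₂ be reals, and let α, β be reals with 0 < α < 1 and 0 < β < 1. Let u ∈ V and set u⁽²⁾ = u + Δt a₂₁ G(u). Then u + Δt (b₁ F(u) + b₂ F(u⁽²⁾)) = (1−α)β ( u − (Δt α a₂₁ / ((1−α)β)) G(u) ) + (1−α)(1−β) ( u + (Δt b₁ / ((1−α)(1−β))) F(u) ) + α ( u⁽²⁾ + (Δt b₂ / α) F(u⁽²⁾) ). -/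
/-- convex decomposition of the second-order cRKDG step. -/
theorem stmt_13 {V : Type*} [AddCommGroup V] [Module ℝ V]
    (F G : V → V) (Δt a21 b1 b2 : ℝ)
    (α β : ℝ) (hα0 : 0 < α) (hα1 : α < 1) (hβ0 : 0 < β) (hβ1 : β < 1)
    (u u2 : V) (hu2 : u2 = u + (Δt * a21) • G u) :
    u + Δt • (b1 • F u + b2 • F u2) =
      ((1 - α) * β) • (u - (Δt * α * a21 / ((1 - α) * β)) • G u) +
      ((1 - α) * (1 - β)) • (u + (Δt * b1 / ((1 - α) * (1 - β))) • F u) +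
      α • (u2 + (Δt * b2 / α) • F u2) := by
  have hα : α ≠ 0 := hα0.ne'
  have hαβ : (1 - α) * β ≠ 0 := (mul_pos (sub_pos.2 hα1) hβ0).ne'
  have hαβ' : (1 - α) * (1 - β) ≠ 0 := (mul_pos (sub_pos.2 hα1) (sub_pos.2 hβ1)).ne'
  generalize F u2 = w
  subst hu2
  rw [smul_sub, smul_add ((1 - α) * (1 - β)), smul_add α, smul_smul, smul_smul, smul_smul α,
    mul_div_cancel₀ _ hαβ, mul_div_cancel₀ _ hαβ', mul_div_cancel₀ _ hα]
  module
end

section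
/- (Inner-stage convex decomposition persists under limiting.) Let V be a real vector space, G : V → V an arbitrary map, Δt a real number, and s ≥ 2 an integer. Let a_{ij} (for 1 ≤ j < i ≤ s) be reals, let β_{ij} ≥ 0 (for 1 ≤ j < i ≤ s) satisfy Σ_{j=1}^{i−1} β_{ij} = 1 for each i ≥ 2, and let μ_{ij} be reals (allowed to be of either sign) such that a_{ij} = β_{ij} μ_{ij} + Σ_{ℓ=j+1}^{i−1} β_{iℓ} a_{ℓj} for all 1 ≤ j < i ≤ s. Let ũ ∈ V and let ṽ⁽¹⁾, …, ṽ⁽ˢ⁾ ∈ V be arbitrary elements (the limited stages). Define u⁽¹⁾ = ũ and, for 2 ≤ i ≤ s, u⁽ⁱ⁾ = ũ + Δt Σ_{j=1}^{i−1} a_{ij} G(ṽ⁽ʲ⁾). Then for every 2 ≤ i ≤ s, u⁽ⁱ⁾ = Σ_{j=1}^{i−1} β_{ij} ( u⁽ʲ⁾ + Δt μ_{ij} G(ṽ⁽ʲ⁾) ). -/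
/-- the inner-stage convex decomposition persists under limiting. -/
theorem stmt_17 {V : Type*} [AddCommGroup V] [Module ℝ V]
    (G : V → V) (Δt : ℝ) (s : ℕ) (hs : 2 ≤ s)
    (a β μ : ℕ → ℕ → ℝ)
    (hβnonneg : ∀ i j, 1 ≤ j → j < i → i ≤ s → 0 ≤ β i j)
    (hβsum : ∀ i, 2 ≤ i → i ≤ s → (∑ j ∈ Finset.Ico 1 i, β i j) = 1)
    (hrel : ∀ i j, 1 ≤ j → j < i → i ≤ s →
      a i j = β i j * μ i j + ∑ l ∈ Finset.Ico (j + 1) i, β i l * a l j)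
    (ut : V) (v : ℕ → V) (u : ℕ → V)
    (hu1 : u 1 = ut)
    (hud : ∀ i, 2 ≤ i → i ≤ s →
      u i = ut + Δt • ∑ j ∈ Finset.Ico 1 i, a i j • G (v j)) :
    ∀ i, 2 ≤ i → i ≤ s →
      u i = ∑ j ∈ Finset.Ico 1 i, β i j • (u j + (Δt * μ i j) • G (v j)) := by
  intro i hi his
  have hu : ∀ j ∈ Finset.Ico 1 i,
      u j = ut + Δt • ∑ k ∈ Finset.Ico 1 j, a j k • G (v k) := by
    intro j hj
    obtain ⟨hj1, hji⟩ := Finset.mem_Ico.mp hj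
    rcases hj1.eq_or_lt with rfl | hj2
    · simp [hu1]
    · exact hud j hj2 (hji.le.trans his)
  have hstage : ∑ k ∈ Finset.Ico 1 i, a i k • G (v k) =
      ∑ j ∈ Finset.Ico 1 i, (β i j * μ i j) • G (v j) +
        ∑ j ∈ Finset.Ico 1 i, β i j • ∑ k ∈ Finset.Ico 1 j, a j k • G (v k) := by
    simp only [Finset.smul_sum, smul_smul]
    rw [← Finset.sum_Ico_Ico_comm' 1 i (fun k j => (β i j * a j k) • G (v k)),
      ← Finset.sum_add_distrib]
    refine Finset.sum_congr rfl fun k hk => ?_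
    obtain ⟨hk1, hki⟩ := Finset.mem_Ico.mp hk
    rw [hrel i k hk1 hki his, add_smul, Finset.sum_smul]
  calc u i = (∑ j ∈ Finset.Ico 1 i, β i j) • ut +
        Δt • ∑ j ∈ Finset.Ico 1 i, a i j • G (v j) := by
        rw [hβsum i hi his, one_smul, hud i hi his]
    _ = ∑ j ∈ Finset.Ico 1 i, β i j • (u j + (Δt * μ i j) • G (v j)) := by
        rw [hstage, Finset.sum_smul, smul_add, Finset.smul_sum, Finset.smul_sum,
          ← Finset.sum_add_distrib, ← Finset.sum_add_distrib]
        refine Finset.sum_congr rfl fun j hj => ?_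
        rw [hu j hj]
        module
end

section
/- (Cell-average identity for the limited second-order cRKDG scheme.) Let V and W be real vector spaces, let A : V → W be a linear map, let F, G : V → V be arbitrary maps, and let Δt be a real number. Let ũⁿ ∈ V, set u⁽²⁾ = ũⁿ + (Δt/2) G(ũⁿ), let ũ⁽²⁾ ∈ V be any element with A ũ⁽²⁾ = A u⁽²⁾, and set u^{n+1} = ũⁿ + Δt F(ũ⁽²⁾). Then A u^{n+1} = (2 − √3) A( ũⁿ − ((√3 + 1)/2) Δt G(ũⁿ) ) + (√3 − 1) A( ũ⁽²⁾ + ((√3 + 1)/2) Δt F(ũ⁽²⁾) ). -/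
/-- cell-average identity for the limited second-order cRKDG
scheme (explicit midpoint rule). -/
theorem stmt_18 {V W : Type*} [AddCommGroup V] [Module ℝ V]
    [AddCommGroup W] [Module ℝ W]
    (A : V →ₗ[ℝ] W) (F G : V → V) (Δt : ℝ)
    (un u2 ut2 un1 : V)
    (hu2 : u2 = un + (Δt / 2) • G un)
    (hA : A ut2 = A u2)
    (hun1 : un1 = un + Δt • F ut2) :
    A un1 = (2 - Real.sqrt 3) • A (un - ((Real.sqrt 3 + 1) / 2 * Δt) • G un) +
      (Real.sqrt 3 - 1) • A (ut2 + ((Real.sqrt 3 + 1) / 2 * Δt) • F ut2) := by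
  have h3 : Real.sqrt 3 * Real.sqrt 3 = 3 := Real.mul_self_sqrt (by norm_num)
  have hF : (Real.sqrt 3 - 1) * ((Real.sqrt 3 + 1) / 2 * Δt) = Δt := by
    linear_combination Δt / 2 * h3
  have hG : (2 - Real.sqrt 3) * ((Real.sqrt 3 + 1) / 2 * Δt) =
      (Real.sqrt 3 - 1) * (Δt / 2) := by
    linear_combination -Δt / 2 * h3
  rw [hun1]
  simp only [map_add, map_sub, map_smul, hA, hu2, smul_add, smul_sub, smul_smul, hF, hG]
  module
end
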